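/- Coherence of the zw-measures (Theorem 8.B): let (z,z') and (w,w') be admissible couples with z+z'+w+w' > −1. For N ≥ 1 and ℓ ∈ Ω_N set M̃_N(ℓ) := ∏_{i=1}^N [ 1/( Γ(z+N−ℓ_i)·Γ(z'+N−ℓ_i)·Γ(w+1+ℓ_i)·Γ(w'+1+ℓ_i) ) ] · V_N(ℓ)². Then each M̃_N(ℓ) is a positive real number, the total mass S_N := ∑_{ℓ∈Ω_N} M̃_N(ℓ) is finite and positive, and the probability distributions M_N := M̃_N/S_N form a coherent family with respect to the Gelfand–Tsetlin links: for every N ≥ 2 and every ℓ' ∈ Ω_{N−1}, ∑_{ℓ∈Ω_N : ℓ'≺ℓ} M_N(ℓ)·Dim_{N−1}(ℓ')/Dim_N(ℓ) = M_{N−1}(ℓ'). -/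

import Mathlib

/-- A couple `(u, u')` of complex numbers is *admissible* if for every integer `l`
the number `(u - l) * (u' - l)` is real and strictly positive. -/
def Admissible (u u' : ℂ) : Prop :=
  ∀ l : ℤ, ((u - l) * (u' - l)).im = 0 ∧ 0 < ((u - l) * (u' - l)).re

/-- The Vandermonde function `V_N(ℓ) = ∏_{1 ≤ i < j ≤ N} (ℓ_i - ℓ_j)`. -/
def Vand (N : ℕ) (ℓ : Fin N → ℤ) : ℤ :=
  ∏ i : Fin N, ∏ j ∈ Finset.Ioi i, (ℓ i - ℓ j)

/-- Membership in `Ω_N = {ℓ ∈ ℤ^N : ℓ_1 > ℓ_2 > ⋯ > ℓ_N}`. -/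
def inOmega {N : ℕ} (ℓ : Fin N → ℤ) : Prop :=
  ∀ i j : Fin N, i < j → ℓ j < ℓ i

/-- `Dim_N(ℓ) = V_N(ℓ)/(1! 2! ⋯ (N-1)!)`. -/
def DimQ (N : ℕ) (ℓ : Fin N → ℤ) : ℚ :=
  (Vand N ℓ : ℚ) / ∏ k ∈ Finset.range N, (Nat.factorial k : ℚ)

/-- `ℓ' ≺ ℓ`: the point `ℓ' ∈ Ω_{N-1}` interlaces `ℓ ∈ Ω_N`, i.e.
`ℓ_{i+1} ≤ ℓ'_i ≤ ℓ_i - 1` for all `i`. -/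
def interlace {M : ℕ} (ℓ' : Fin M → ℤ) (ℓ : Fin (M + 1) → ℤ) : Prop :=
  ∀ i : Fin M, ℓ i.succ ≤ ℓ' i ∧ ℓ' i ≤ ℓ i.castSucc - 1

/-- The (unnormalized) `zw`-measure
`M̃_N(ℓ) = ∏_i [Γ(z+N-ℓ_i) Γ(z'+N-ℓ_i) Γ(w+1+ℓ_i) Γ(w'+1+ℓ_i)]⁻¹ · V_N(ℓ)²`. -/
noncomputable def MtC (z z' w w' : ℂ) (N : ℕ) (ℓ : Fin N → ℤ) : ℂ :=
  (∏ i : Fin N,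
      (1 / (Complex.Gamma (z + (N : ℂ) - (ℓ i : ℂ)) * Complex.Gamma (z' + (N : ℂ) - (ℓ i : ℂ)) *
            Complex.Gamma (w + 1 + (ℓ i : ℂ)) * Complex.Gamma (w' + 1 + (ℓ i : ℂ))))) *
    ((Vand N ℓ : ℂ)) ^ 2

/-- The total mass `S_N = ∑_{ℓ ∈ Ω_N} M̃_N(ℓ)` (as a sum of the real values `M̃_N(ℓ)`). -/
noncomputable def Smass (z z' w w' : ℂ) (N : ℕ) : ℝ :=
  ∑' ℓ : {ℓ : Fin N → ℤ // inOmega ℓ}, (MtC z z' w w' N ℓ.1).re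

open Finset Matrix Polynomial

theorem HasSum.mul_prod {α β : Type*} {f : α → ℝ} {g : β → ℝ} {a b : ℝ} (hf : HasSum f a)
    (hg : HasSum g b) : HasSum (fun p : α × β => f p.1 * g p.2) (a * b) := by
  have hf' : Summable fun x => ‖f x‖ := hf.summable.abs
  have hg' : Summable fun x => ‖g x‖ := hg.summable.abs
  exact hf.mul hg (summable_mul_of_summable_norm hf' hg')

/-- The sum over a finite product of index types of a product of summable functions. -/
theorem hasSum_fin_pi_prod {n : ℕ} {f : Fin n → ℤ → ℝ} {s : Fin n → ℝ}
    (hf : ∀ i, HasSum (f i) (s i)) :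
    HasSum (fun x : Fin n → ℤ => ∏ i, f i (x i)) (∏ i, s i) := by
  induction n with
  | zero => simp
  | succ n ih =>
    have h0 := hf 0
    have h1 := ih fun i : Fin n => hf i.succ
    have h2 := h0.mul_prod h1
    rw [← (Fin.consEquiv fun _ : Fin (n + 1) => ℤ).hasSum_iff]
    rw [Fin.prod_univ_succ]
    convert h2 using 2 with x
    simp [Fin.prod_univ_succ, Fin.consEquiv]

theorem hasSum_det {n : ℕ} {f : Fin n → Fin n → ℤ → ℝ} {A : Fin n → Fin n → ℝ}
    (hf : ∀ i j, HasSum (f i j) (A i j)) :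
    HasSum (fun x : Fin n → ℤ => (Matrix.of fun i j => f i j (x i)).det) (Matrix.of A).det := by
  simp only [← Matrix.det_transpose (Matrix.of _), Matrix.det_apply']
  refine hasSum_sum fun σ _ => HasSum.mul_left _ ?_
  simpa using hasSum_fin_pi_prod fun i => hf i (σ i)

open Classical in
/-- Summation of a determinant over a box: the sum can be taken row by row. -/
theorem hasSum_indicator_mul_det {n : ℕ} {I : Fin n → Set ℤ} {f : ℤ → ℝ} {φ : Fin n → ℤ → ℝ}
    {A : Fin n → Fin n → ℝ}
    (hf : ∀ i j, HasSum ((I i).indicator fun x => f x * φ j x) (A i j)) :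
    HasSum (fun x : Fin n → ℤ => if ∀ i, x i ∈ I i then
      (∏ i, f (x i)) * (Matrix.of fun i j => φ j (x i)).det else 0) (Matrix.of A).det := by
  convert hasSum_det hf using 2 with x
  have : ∀ i j, (I i).indicator (fun x => f x * φ j x) (x i)
      = (if x i ∈ I i then f (x i) else 0) * Matrix.of (fun i j => φ j (x i)) i j := by
    intro i j
    by_cases h : x i ∈ I i <;> simp [h]
  simp only [this, Matrix.det_mul_column]
  split_ifs with h
  · simp [h]
  · push Not at h
    obtain ⟨i, hi⟩ := h
    rw [Finset.prod_eq_zero (mem_univ i) (by simp [hi]), zero_mul]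

/-- The Vandermonde function as a determinant in monic polynomials of the variables `-ℓ i`. -/
theorem det_eval_neg_eq_vand {n : ℕ} (ℓ : Fin n → ℤ) (p : Fin n → ℝ[X])
    (h_deg : ∀ i, (p i).natDegree = i) (h_monic : ∀ i, (p i).Monic) :
    (Matrix.of fun i j => (p j).eval (-(ℓ i : ℝ))).det = (Vand n ℓ : ℝ) := by
  rw [← Matrix.det_eval_matrixOfPolynomials_eq_det_vandermonde _ p h_deg h_monic,
    Matrix.det_vandermonde, Vand]
  push_cast
  refine prod_congr rfl fun i _ => prod_congr rfl fun j _ => by ring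

theorem vand_pos {n : ℕ} {ℓ : Fin n → ℤ} (h : inOmega ℓ) : 0 < Vand n ℓ :=
  prod_pos fun i _ => prod_pos fun j hj => sub_pos.2 (h i j (mem_Ioi.1 hj))

theorem inOmega_iff_strictAnti {n : ℕ} {ℓ : Fin n → ℤ} : inOmega ℓ ↔ StrictAnti ℓ :=
  ⟨fun h _ _ hij => h _ _ hij, fun h _ _ hij => h hij⟩

theorem interlace.inOmega_right {M : ℕ} {ℓ' : Fin M → ℤ} {ℓ : Fin (M + 1) → ℤ}
    (h : interlace ℓ' ℓ) : inOmega ℓ :=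
  inOmega_iff_strictAnti.2 <| Fin.strictAnti_iff_succ_lt.2 fun i => by
    have := h i
    omega

theorem interlace.inOmega_left {M : ℕ} {ℓ' : Fin M → ℤ} {ℓ : Fin (M + 1) → ℤ}
    (h : interlace ℓ' ℓ) : inOmega ℓ' := by
  intro i j hij
  have h1 := (h i).1
  have h2 := (h j).2
  have h3 : ℓ j.castSucc ≤ ℓ i.succ :=
    (inOmega_iff_strictAnti.1 h.inOmega_right).antitone (Fin.le_def.2 (by simpa using hij))
  omega

theorem hasSum_Ico_ascPochhammer (j : ℕ) {a b : ℤ} (hab : a ≤ b) :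
    HasSum ((Set.Ico a b).indicator fun x : ℤ => 1 * (ascPochhammer ℝ j).eval (-(x : ℝ)))
      (((ascPochhammer ℝ (j + 1)).eval (-(a : ℝ)) - (ascPochhammer ℝ (j + 1)).eval (-(b : ℝ)))
        / (j + 1)) := by
  have key : ∑ x ∈ Finset.Ico a b, (ascPochhammer ℝ j).eval (-(x : ℝ)) =
      ((ascPochhammer ℝ (j + 1)).eval (-(a : ℝ)) - (ascPochhammer ℝ (j + 1)).eval (-(b : ℝ)))
        / (j + 1) := by
    induction b, hab using Int.leInduction with
    | base => simp
    | succ b hb ih =>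
      have h1 := ascPochhammer_succ_eval j (-(b : ℝ))
      have h2 : (ascPochhammer ℝ (j + 1)).eval (-((b + 1 : ℤ) : ℝ)) =
          -((b + 1 : ℤ) : ℝ) * (ascPochhammer ℝ j).eval (-(b : ℝ)) := by
        rw [ascPochhammer_succ_left]
        simp
      have h3 : (j : ℝ) + 1 ≠ 0 := by positivity
      rw [← Finset.insert_Ico_right_eq_Ico_add_one hb, Finset.sum_insert (by simp), ih, h2, h1]
      push_cast
      field_simp
      ring
  rw [← key]
  simp only [one_mul]
  rw [← Finset.sum_coe_sort, ← Finset.coe_Ico, ← hasSum_subtype_iff_indicator]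
  exact hasSum_fintype _

open Classical in
/-- The branching rule for the dimensions `Dim_N`. -/
theorem hasSum_vand_interlace {M : ℕ} {ℓ : Fin (M + 1) → ℤ} (hℓ : inOmega ℓ) :
    HasSum (fun ℓ' : Fin M → ℤ => if interlace ℓ' ℓ then (Vand M ℓ' : ℝ) else 0)
      ((Vand (M + 1) ℓ : ℝ) / M.factorial) := by
  have hs := hasSum_indicator_mul_det (n := M) (f := fun _ => 1)
    (φ := fun j x => (ascPochhammer ℝ j).eval (-(x : ℝ)))
    (I := fun i => Set.Ico (ℓ i.succ) (ℓ i.castSucc)) fun _ j =>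
      hasSum_Ico_ascPochhammer j (hℓ _ _ Fin.castSucc_lt_succ).le
  have hv : ∀ ℓ' : Fin M → ℤ, (Matrix.of fun i j : Fin M =>
      (ascPochhammer ℝ j).eval (-(ℓ' i : ℝ))).det = (Vand M ℓ' : ℝ) := fun ℓ' =>
    det_eval_neg_eq_vand ℓ' (fun j => ascPochhammer ℝ j)
      (fun j => ascPochhammer_natDegree _ _) fun j => monic_ascPochhammer _ _
  simp only [prod_const_one, one_mul, hv] at hs
  convert hs using 1
  · ext ℓ'
    congr 1
    simp only [interlace, Set.mem_Ico, Int.le_sub_one_iff]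
  · rw [← det_eval_neg_eq_vand ℓ (fun j => ascPochhammer ℝ j)
      (fun j => ascPochhammer_natDegree _ _) fun j => monic_ascPochhammer _ _]
    set D : Fin M → Fin M → ℝ := fun i j =>
      (ascPochhammer ℝ (j + 1)).eval (-(ℓ i.succ : ℝ))
        - (ascPochhammer ℝ (j + 1)).eval (-(ℓ i.castSucc : ℝ)) with hD
    have h1 : (Matrix.of fun i j : Fin M => D i j / ((j : ℕ) + 1 : ℝ)).det
        = (M.factorial : ℝ)⁻¹ * (Matrix.of D).det := by
      have := Matrix.det_mul_row (fun j : Fin M => ((j : ℕ) + 1 : ℝ)⁻¹) (Matrix.of D)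
      rw [Finset.prod_inv_distrib, Fin.prod_univ_eq_prod_range (fun k => (k + 1 : ℝ)) M] at this
      rw [← Finset.prod_range_add_one_eq_factorial]
      push_cast
      rw [← this]
      congr 1
      ext i j
      simp [div_eq_inv_mul]
    rw [h1, div_eq_inv_mul]
    congr 1
    let B : Matrix (Fin (M + 1)) (Fin (M + 1)) ℝ := Matrix.of <| Fin.cons
      (fun j => (ascPochhammer ℝ j).eval (-(ℓ 0 : ℝ))) fun i j =>
        (ascPochhammer ℝ j).eval (-(ℓ i.succ : ℝ))
        - (ascPochhammer ℝ j).eval (-(ℓ i.castSucc : ℝ))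
    rw [Matrix.det_eq_of_forall_row_eq_smul_add_pred (B := B) (fun _ => 1) (fun j => by simp [B])
      fun i j => by simp [B], Matrix.det_succ_column_zero, Fin.sum_univ_succ,
      Finset.sum_eq_zero fun i _ => by simp [B]]
    simp only [B, Matrix.submatrix]
    simp
    rfl

/-- Positive weights `F N x` on the integers satisfying the two contiguity relations of the
`zw`-weights, with `a, b` (resp. `c, d`) the sum and the product of `z, z'` (resp. `w, w'`). -/
structure IsContiguousWeight (F : ℕ → ℤ → ℝ) (a b c d : ℝ) : Prop where
  pos : ∀ N x, 0 < F N x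
  rec_left : ∀ N x, F N x = F (N + 1) x * ((N - x) ^ 2 + a * (N - x) + b)
  rec_right : ∀ N x, F N (x - 1) = F (N + 1) x * (x ^ 2 + c * x + d)
  neg_one_lt : -1 < a + c

theorem exists_forall_quadratic_nonneg {α : ℝ} (hα : 0 < α) (β γ : ℝ) :
    ∃ R : ℕ, ∀ x : ℝ, R ≤ |x| → 0 ≤ α * x ^ 2 + β * x + γ := by
  obtain ⟨R, hR⟩ := exists_nat_ge (max 1 ((|β| + |γ|) / α))
  refine ⟨R, fun x hx => ?_⟩
  have h1 : 1 ≤ |x| := (le_max_left _ _).trans (hR.trans hx)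
  have h2 : |β| + |γ| ≤ α * |x| := by
    rw [← div_le_iff₀' hα]
    exact (le_max_right _ _).trans (hR.trans hx)
  have h3 : -(|β| * |x|) ≤ β * x := by
    rw [← abs_mul]
    exact neg_abs_le _
  have h4 := neg_abs_le γ
  rw [← sq_abs x]
  nlinarith [abs_nonneg β, abs_nonneg γ, mul_le_mul_of_nonneg_right h2 (abs_nonneg x),
    mul_le_mul_of_nonneg_left h1 (abs_nonneg γ)]

theorem eventually_cofinite_quadratic_nonneg {α : ℝ} (hα : 0 < α) (β γ : ℝ) :
    ∀ᶠ x : ℤ in Filter.cofinite, 0 ≤ α * (x : ℝ) ^ 2 + β * x + γ := by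
  obtain ⟨R, hR⟩ := exists_forall_quadratic_nonneg hα β γ
  refine (Set.finite_Icc (-(R : ℤ)) R).subset fun x hx => ?_
  by_contra h
  refine hx (hR x ?_)
  have : (R : ℤ) ≤ |x| := by
    by_contra hlt
    exact h (abs_le.1 (not_le.1 hlt).le)
  exact_mod_cast this

/-- A Raabe-type criterion for summability. -/
theorem summable_nat_of_ratio {f : ℤ → ℝ} {a b c d : ℝ} (hf : ∀ x, 0 < f x)
    (hP : ∀ x : ℤ, 0 < (x : ℝ) ^ 2 - a * x + b)
    (hrec : ∀ x : ℤ, f x * ((x : ℝ) ^ 2 + c * x + d) =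
      f (x - 1) * (((x : ℝ) - 1) ^ 2 - a * (x - 1) + b))
    (h : -1 < a + c) : Summable fun n : ℕ => f n := by
  set δ := (a + c + 1) / 2 with hδ
  have hδ0 : 0 < δ := by linarith
  obtain ⟨R, hR⟩ := exists_forall_quadratic_nonneg (α := δ) hδ0
    (d - c - (1 + a + b) + δ * (2 + a)) (-d - δ * (1 + a + b))
  have key : ∀ n : ℕ, R ≤ n → δ * f n ≤ (n - 1) * f (n - 1) - n * f n := by
    intro n hn
    have hq := hR n (by simpa using hn)
    have hp := hP ((n : ℤ) - 1)
    have hr := hrec n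
    push_cast at hp hr
    refine le_of_mul_le_mul_right ?_ hp
    have : ((n - 1) * f (n - 1) - n * f n) * (((n : ℝ) - 1) ^ 2 - a * (n - 1) + b)
        - δ * f n * (((n : ℝ) - 1) ^ 2 - a * (n - 1) + b)
        = f n * (δ * (n : ℝ) ^ 2 + (d - c - (1 + a + b) + δ * (2 + a)) * n
          + (-d - δ * (1 + a + b))) := by
      linear_combination (1 - (n : ℝ)) * hr - f n * (n : ℝ) ^ 2 * 2 * hδ
    nlinarith [mul_nonneg (hf n).le hq]
  rw [← summable_nat_add_iff (R + 1)]
  refine summable_of_sum_range_le (c := R * f R / δ) (fun n => (hf _).le) fun n => ?_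
  rw [le_div_iff₀' hδ0]
  suffices H : δ * ∑ i ∈ range n, f ((i + (R + 1) : ℕ) : ℤ) ≤ R * f R - (R + n) * f (R + n) by
    have : 0 ≤ ((R : ℝ) + n) * f (R + n) := mul_nonneg (by positivity) (hf _).le
    linarith
  induction n with
  | zero => simp
  | succ n ih =>
    rw [sum_range_succ, mul_add]
    have := key (n + (R + 1)) (by omega)
    have e1 : (((n + (R + 1) : ℕ) : ℤ)) - 1 = R + n := by push_cast; ring
    have e2 : (((n + (R + 1) : ℕ) : ℤ)) = R + (n + 1 : ℕ) := by push_cast; ring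
    rw [e1, e2] at this
    rw [e2]
    push_cast at this ih ⊢
    linarith

namespace IsContiguousWeight

variable {F : ℕ → ℤ → ℝ} {a b c d : ℝ}

theorem left_pos (hF : IsContiguousWeight F a b c d) (N : ℕ) (x : ℤ) :
    0 < ((N : ℝ) - x) ^ 2 + a * (N - x) + b :=
  pos_of_mul_pos_right (hF.rec_left N x ▸ hF.pos N x) (hF.pos _ _).le

theorem right_pos (hF : IsContiguousWeight F a b c d) (x : ℤ) : 0 < (x : ℝ) ^ 2 + c * x + d :=
  pos_of_mul_pos_right (hF.rec_right 0 x ▸ hF.pos 0 (x - 1)) (hF.pos _ _).le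

theorem summable_one (hF : IsContiguousWeight F a b c d) : Summable (F 1) := by
  have hP : ∀ x : ℤ, 0 < (x : ℝ) ^ 2 - a * x + b := fun x => by
    simpa [sub_eq_add_neg] using hF.left_pos 0 x
  have hrec : ∀ x : ℤ, F 1 x * ((x : ℝ) ^ 2 + c * x + d) =
      F 1 (x - 1) * (((x : ℝ) - 1) ^ 2 - a * (x - 1) + b) := fun x => by
    have h1 := hF.rec_left 0 (x - 1)
    have h2 := hF.rec_right 0 x
    push_cast at h1
    simp only [zero_add] at h1 h2
    linear_combination h1 - h2
  refine Summable.of_nat_of_neg (summable_nat_of_ratio (hF.pos 1) hP hrec hF.neg_one_lt)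
    (summable_nat_of_ratio (f := fun x => F 1 (-x)) (a := c) (b := d) (c := a) (d := b)
      (fun x => hF.pos 1 _) (fun x => ?_) (fun x => ?_) (by linarith [hF.neg_one_lt]))
  · simpa [sub_eq_add_neg] using hF.right_pos (-x)
  · have := hrec (1 - x)
    rw [show (1 - x - 1 : ℤ) = -x by ring] at this
    push_cast at this
    rw [show -(x - 1) = 1 - x by ring]
    linear_combination -this

theorem summable_mul_pow_two_mul (hF : IsContiguousWeight F a b c d) (n : ℕ) :
    Summable fun x : ℤ => F (n + 1) x * (x : ℝ) ^ (2 * n) := by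
  induction n with
  | zero => simpa using hF.summable_one
  | succ n ih =>
    refine .of_norm_bounded_eventually (ih.mul_left 2) ?_
    filter_upwards [eventually_cofinite_quadratic_nonneg one_pos
      (-4 * (n + 1) - 2 * a) (2 * ((n + 1) ^ 2 + a * (n + 1) + b))] with x hx
    have hn : 0 ≤ (x : ℝ) ^ (2 * n) := (even_two_mul n).pow_nonneg _
    have hF0 := (hF.pos (n + 1 + 1) x).le
    rw [Real.norm_of_nonneg (mul_nonneg hF0 ((even_two_mul _).pow_nonneg _)),
      hF.rec_left (n + 1) x]
    push_cast
    have := mul_nonneg (mul_nonneg hF0 hn) hx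
    rw [mul_add 2 n 1, pow_add, mul_one]
    linarith

theorem summable_mul_pow (hF : IsContiguousWeight F a b c d) {n k : ℕ} (hk : k ≤ 2 * n) :
    Summable fun x : ℤ => F (n + 1) x * (x : ℝ) ^ k := by
  refine .of_norm_bounded_eventually (hF.summable_mul_pow_two_mul n) ?_
  refine (Set.finite_singleton (0 : ℤ)).subset fun x hx => ?_
  by_contra h0
  refine hx (show ‖F (n + 1) x * (x : ℝ) ^ k‖ ≤ F (n + 1) x * (x : ℝ) ^ (2 * n) from ?_)
  have h1 : (1 : ℝ) ≤ |(x : ℝ)| := by exact_mod_cast Int.one_le_abs h0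
  rw [norm_mul, Real.norm_of_nonneg (hF.pos _ _).le, norm_pow, Real.norm_eq_abs,
    ← (even_two_mul n).pow_abs]
  exact mul_le_mul_of_nonneg_left (pow_le_pow_right₀ h1 hk) (hF.pos _ _).le

theorem summable_mul_neg_pow (hF : IsContiguousWeight F a b c d) {n k : ℕ} (hk : k ≤ 2 * n) :
    Summable fun x : ℤ => F (n + 1) x * (-x : ℝ) ^ k := by
  refine ((hF.summable_mul_pow hk).mul_left ((-1) ^ k)).congr fun x => ?_
  rw [neg_pow (x : ℝ)]
  ring

theorem summable_mul_eval (hF : IsContiguousWeight F a b c d) {n : ℕ} {p : ℝ[X]}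
    (hp : p.natDegree ≤ 2 * n) : Summable fun x : ℤ => F (n + 1) x * p.eval (-x : ℝ) := by
  simp only [eval_eq_sum_range, mul_sum]
  refine summable_sum fun k hk => ?_
  have hk' : k ≤ 2 * n := (Nat.le_of_lt_succ (mem_range.1 hk)).trans hp
  exact ((hF.summable_mul_neg_pow hk').mul_left (p.coeff k)).congr fun x => by ring

/-- Finiteness of the total mass of the discrete orthogonal polynomial ensemble of weight `F`. -/
theorem summable_prod_mul_vand_sq (hF : IsContiguousWeight F a b c d) (n : ℕ) :
    Summable fun ℓ : Fin (n + 1) → ℤ => (∏ i, F (n + 1) (ℓ i)) * (Vand (n + 1) ℓ : ℝ) ^ 2 := by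
  have hV : ∀ ℓ : Fin (n + 1) → ℤ, (∏ i, F (n + 1) (ℓ i)) * (Vand (n + 1) ℓ : ℝ) ^ 2 =
      ∑ σ : Equiv.Perm (Fin (n + 1)), ∑ τ : Equiv.Perm (Fin (n + 1)),
        (((σ.sign : ℤ) : ℝ) * ((τ.sign : ℤ) : ℝ)) *
          ∏ i, F (n + 1) (ℓ i) * (-(ℓ i) : ℝ) ^ ((σ i : ℕ) + (τ i : ℕ)) := by
    intro ℓ
    rw [← det_eval_neg_eq_vand ℓ (fun j => X ^ (j : ℕ)) (by simp) fun j => monic_X_pow _,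
      ← Matrix.det_transpose, Matrix.det_apply', sq, sum_mul_sum, mul_sum]
    refine sum_congr rfl fun σ _ => ?_
    rw [mul_sum]
    refine sum_congr rfl fun τ _ => ?_
    simp only [pow_add, prod_mul_distrib, Matrix.transpose_apply, Matrix.of_apply, eval_pow, eval_X]
    ring
  simp only [hV]
  refine summable_sum fun σ _ => summable_sum fun τ _ => Summable.mul_left _ ?_
  have := hasSum_fin_pi_prod fun i : Fin (n + 1) => (hF.summable_mul_neg_pow (n := n)
    (k := (σ i : ℕ) + (τ i : ℕ)) (by omega)).hasSum
  exact this.summable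

end IsContiguousWeight

theorem hasSum_sub_shift {G : ℤ → ℝ} (hG : Summable G) : HasSum (fun x => G x - G (x - 1)) 0 := by
  have h : HasSum (fun x => G (x - 1)) (∑' x, G x) :=
    (Equiv.subRight (1 : ℤ)).hasSum_iff.2 hG.hasSum
  simpa using hG.hasSum.sub h

theorem hasSum_indicator_Ioi_sub_shift {G : ℤ → ℝ} (hG : Summable G) (y : ℤ) :
    HasSum ((Set.Ioi y).indicator fun x => G x - G (x - 1)) (-G y) := by
  have h := (hasSum_sub_shift (hG.indicator (Set.Ioi y))).sub (hasSum_ite_eq (y + 1) (G y))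
  rw [zero_sub] at h
  convert! h using 2 with x
  simp only [Set.indicator_apply, Set.mem_Ioi]
  rcases lt_trichotomy x (y + 1) with hx | rfl | hx
  · rw [if_neg (by omega), if_neg (by omega), if_neg (by omega), if_neg (by omega)]
    simp
  · simp
  · rw [if_pos (by omega), if_pos (by omega), if_pos (by omega), if_neg (by omega)]
    simp

/-- The polynomial in `t = -x` that describes the discrete derivative of `F N x * t ^ j`. -/
noncomputable def contiguityPoly (a b c d : ℝ) (N j : ℕ) : ℝ[X] :=
  ((X + C (N : ℝ)) ^ 2 + C a * (X + C (N : ℝ)) + C b) * X ^ j -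
    (X ^ 2 - C c * X + C d) * (X + C 1) ^ j

theorem contiguityPoly_succ (a b c d : ℝ) (N j : ℕ) : contiguityPoly a b c d N (j + 1) =
    X * contiguityPoly a b c d N j - (X ^ 2 - C c * X + C d) * (X + C 1) ^ j := by
  simp only [contiguityPoly, map_one]
  ring

theorem natDegree_coeff_contiguityPoly (a b c d : ℝ) (N j : ℕ) :
    (contiguityPoly a b c d N j).natDegree ≤ j + 1 ∧
      (contiguityPoly a b c d N j).coeff (j + 1) = 2 * N + a + c - j := by
  induction j with
  | zero =>
    have : contiguityPoly a b c d N 0 =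
        C (2 * N + a + c) * X + C (N ^ 2 + a * N + b - d) := by
      simp only [contiguityPoly, map_add, map_sub, map_mul, map_pow, C_ofNat]
      ring
    rw [this]
    exact ⟨natDegree_linear_le, by simp only [coeff_add, coeff_C_mul, coeff_C]; simp⟩
  | succ j ih =>
    obtain ⟨h1, h2⟩ := ih
    have hQ : (X ^ 2 - C c * X + C d : ℝ[X]).natDegree = 2 := by compute_degree!
    have hQm : (X ^ 2 - C c * X + C d : ℝ[X]).Monic := by
      rw [Monic, leadingCoeff, hQ]
      simp
    have hm : ((X ^ 2 - C c * X + C d) * (X + C 1) ^ j : ℝ[X]).Monic :=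
      hQm.mul ((monic_X_add_C 1).pow j)
    have hd : ((X ^ 2 - C c * X + C d) * (X + C 1) ^ j : ℝ[X]).natDegree = j + 1 + 1 := by
      rw [hQm.natDegree_mul ((monic_X_add_C 1).pow j), hQ, natDegree_pow, natDegree_X_add_C]
      ring
    have hc : ((X ^ 2 - C c * X + C d) * (X + C 1) ^ j : ℝ[X]).coeff (j + 1 + 1) = 1 := by
      rw [← hd]
      exact hm
    rw [contiguityPoly_succ]
    refine ⟨(natDegree_sub_le _ _).trans (max_le ?_ hd.le), ?_⟩
    · refine natDegree_mul_le.trans ?_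
      rw [natDegree_X]
      omega
    · rw [coeff_sub, coeff_X_mul, h2, hc]
      push_cast
      ring

/-- The monic polynomials, one in each degree, all of which but the first sum to zero against the
weight `F (N + 1)`. -/
noncomputable def contiguityBasis (a b c d : ℝ) (N : ℕ) : Fin (N + 1) → ℝ[X] :=
  Fin.cons 1 fun j => C (2 * N + a + c - j)⁻¹ * contiguityPoly a b c d N j

namespace IsContiguousWeight

variable {F : ℕ → ℤ → ℝ} {a b c d : ℝ}

theorem leading_pos (hF : IsContiguousWeight F a b c d) {N : ℕ} (j : Fin N) :
    0 < 2 * N + a + c - (j : ℝ) := by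
  have h1 : (j : ℝ) + 1 ≤ N := by exact_mod_cast j.2
  have h2 : (0 : ℝ) ≤ N := N.cast_nonneg
  linarith [hF.neg_one_lt]

theorem contiguityBasis_natDegree_monic (hF : IsContiguousWeight F a b c d) {N : ℕ}
    (j : Fin (N + 1)) : (contiguityBasis a b c d N j).natDegree = j ∧
      (contiguityBasis a b c d N j).Monic := by
  cases j using Fin.cases with
  | zero => simp [contiguityBasis]
  | succ j =>
    obtain ⟨h1, h2⟩ := natDegree_coeff_contiguityPoly a b c d N j
    have hc : (contiguityBasis a b c d N j.succ).coeff (j + 1) = 1 := by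
      rw [contiguityBasis, Fin.cons_succ, coeff_C_mul, h2, inv_mul_cancel₀ (hF.leading_pos j).ne']
    have hd : (contiguityBasis a b c d N j.succ).natDegree ≤ j + 1 := by
      rw [contiguityBasis, Fin.cons_succ]
      exact (natDegree_C_mul_le _ _).trans h1
    refine ⟨le_antisymm (by simpa using hd) ?_, monic_of_natDegree_le_of_coeff_eq_one _ hd hc⟩
    exact le_natDegree_of_ne_zero (by simp [hc])

theorem mul_eval_contiguityBasis_succ (hF : IsContiguousWeight F a b c d) {N : ℕ} (j : Fin N)
    (x : ℤ) : F (N + 1) x * (contiguityBasis a b c d N j.succ).eval (-x : ℝ) =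
      (2 * N + a + c - (j : ℝ))⁻¹ * (F N x * (-x : ℝ) ^ (j : ℕ)) -
      (2 * N + a + c - (j : ℝ))⁻¹ * (F N (x - 1) * (-((x - 1 : ℤ) : ℝ)) ^ (j : ℕ)) := by
  rw [contiguityBasis, Fin.cons_succ, hF.rec_left N x, hF.rec_right N x]
  simp only [contiguityPoly, eval_mul, eval_C, eval_sub, eval_add, eval_pow, eval_X]
  push_cast
  rw [show -((x : ℝ) - 1) = -x + 1 by ring]
  ring

open Classical in
/-- Summing the weighted Vandermonde function over all `ℓ` interlacing with a given `ℓ'`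
reproduces it one level below. -/
theorem hasSum_interlace (hF : IsContiguousWeight F a b c d) (n : ℕ) {ℓ' : Fin (n + 1) → ℤ}
    (hℓ' : inOmega ℓ') :
    HasSum (fun ℓ : Fin (n + 2) → ℤ => if interlace ℓ' ℓ then
        (∏ i, F (n + 2) (ℓ i)) * (Vand (n + 2) ℓ : ℝ) else 0)
      ((∑' x, F (n + 2) x) * (∏ j : Fin (n + 1), (2 * (n + 1 : ℕ) + a + c - (j : ℝ))⁻¹) *
        ((∏ i, F (n + 1) (ℓ' i)) * (Vand (n + 1) ℓ' : ℝ))) := by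
  set κ : Fin (n + 1) → ℝ := fun j => 2 * (n + 1 : ℕ) + a + c - (j : ℝ) with hκ
  set p := contiguityBasis a b c d (n + 1) with hp
  let u : Fin (n + 2) → ℤ → ℝ := fun j x => F (n + 2) x * (p j).eval (-x : ℝ)
  let E : Fin (n + 2) → Set ℤ :=
    Fin.snoc (α := fun _ => Set ℤ) (fun i => Set.Ioi (ℓ' i)) Set.univ
  have hE : ∀ i : Fin (n + 1), E i.castSucc = Set.Ioi (ℓ' i) := fun i => by simp [E]
  have hElast : E (Fin.last _) = Set.univ := by simp [E]
  have hEmono : ∀ i : Fin (n + 1), E i.castSucc ⊆ E i.succ := by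
    intro i
    cases i using Fin.lastCases with
    | last => rw [Fin.succ_last, hElast]; exact Set.subset_univ _
    | cast i =>
      rw [hE, ← Fin.castSucc_succ, hE]
      exact Set.Ioi_subset_Ioi (hℓ' _ _ Fin.castSucc_lt_succ).le
  have hu : ∀ j, Summable (u j) := fun j => hF.summable_mul_eval (n := n + 1) <| by
    rw [hp, (hF.contiguityBasis_natDegree_monic j).1]
    omega
  let B : Matrix (Fin (n + 2)) (Fin (n + 2)) ℝ := .of fun i j => ∑' x, (E i).indicator (u j) x
  have hB : ∀ i j, HasSum ((E i).indicator (u j)) (B i j) := fun i j =>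
    ((hu j).indicator _).hasSum
  have hG : ∀ j : Fin (n + 1),
      Summable fun x : ℤ => (κ j)⁻¹ * (F (n + 1) x * (-x : ℝ) ^ (j : ℕ)) := fun j =>
    (hF.summable_mul_neg_pow (by omega)).mul_left _
  have huG : ∀ j : Fin (n + 1), u j.succ = fun x => _ :=
    fun j => funext fun x => hF.mul_eval_contiguityBasis_succ j x
  have hB1 : B (Fin.last _) 0 = ∑' x, F (n + 2) x := by
    simp [B, u, hElast, hp, contiguityBasis]
  have hB2 : ∀ j : Fin (n + 1), B (Fin.last _) j.succ = 0 := fun j => by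
    refine (hB _ _).unique ?_
    rw [hElast, Set.indicator_univ, huG]
    exact hasSum_sub_shift (hG j)
  have hB3 : ∀ i j : Fin (n + 1), B i.castSucc j.succ =
      -(κ j)⁻¹ * (F (n + 1) (ℓ' i) * (-(ℓ' i) : ℝ) ^ (j : ℕ)) := fun i j => by
    rw [neg_mul]
    refine (hB _ _).unique ?_
    rw [hE, huG]
    exact hasSum_indicator_Ioi_sub_shift (hG j) (ℓ' i)
  let A : Fin (n + 2) → Fin (n + 2) → ℝ :=
    Fin.cons (fun j => B 0 j) fun i j => B i.succ j - B i.castSucc j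
  let I : Fin (n + 2) → Set ℤ :=
    Fin.cons (α := fun _ => Set ℤ) (E 0) fun i => E i.succ \ E i.castSucc
  have hA : ∀ i j, HasSum ((I i).indicator (u j)) (A i j) := by
    intro i j
    cases i using Fin.cases with
    | zero => simpa [I, A] using hB 0 j
    | succ i =>
      simp only [I, A, Fin.cons_succ]
      rw [Set.indicator_sdiff (hEmono i)]
      exact (hB _ _).sub (hB _ _)
  have hI : ∀ ℓ : Fin (n + 2) → ℤ, (∀ i, ℓ i ∈ I i) ↔ interlace ℓ' ℓ := by
    intro ℓ
    have : (∀ i, ℓ i ∈ I i) ↔ (∀ i, ℓ i ∈ E i) ∧ ∀ i : Fin (n + 1), ℓ i.succ ∉ E i.castSucc := by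
      rw [Fin.forall_fin_succ, Fin.forall_fin_succ (P := fun i => ℓ i ∈ E i)]
      simp only [I, Fin.cons_zero, Fin.cons_succ, Set.mem_sdiff, forall_and, and_assoc]
    rw [this, Fin.forall_fin_succ']
    simp only [hE, hElast, Set.mem_univ, and_true, Set.mem_Ioi, not_lt, ← forall_and, interlace]
    exact forall_congr' fun i => by omega
  have hdet : (Matrix.of A).det = (∑' x, F (n + 2) x) * (∏ j, (κ j)⁻¹) *
      ((∏ i, F (n + 1) (ℓ' i)) * (Vand (n + 1) ℓ' : ℝ)) := by
    rw [← Matrix.det_eq_of_forall_row_eq_smul_add_pred (A := B) (B := Matrix.of A) (fun _ => 1)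
      (fun j => by simp [A]) fun i j => by simp [A], Matrix.det_succ_row B (Fin.last _),
      Fin.sum_univ_succ, Finset.sum_eq_zero fun j _ => by rw [hB2]; ring, hB1, add_zero]
    have hsub : B.submatrix (Fin.last (n + 1)).succAbove (Fin.succAbove 0) =
        .of fun i j => -(κ j)⁻¹ * Matrix.of (fun i j : Fin (n + 1) => F (n + 1) (ℓ' i) *
          Matrix.of (fun i j : Fin (n + 1) => (X ^ (j : ℕ) : ℝ[X]).eval (-(ℓ' i) : ℝ)) i j) i j := by
      ext i j
      simp [hB3]
    rw [hsub, Matrix.det_mul_row, Matrix.det_mul_column,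
      det_eval_neg_eq_vand ℓ' (fun j => X ^ (j : ℕ)) (by simp) fun j => monic_X_pow _,
      Finset.prod_neg]
    simp only [Fin.val_last, Fin.val_zero, add_zero, card_univ, Fintype.card_fin]
    linear_combination (∑' x, F (n + 2) x) * (∏ j, (κ j)⁻¹) *
      ((∏ i, F (n + 1) (ℓ' i)) * (Vand (n + 1) ℓ' : ℝ)) *
      (by rw [← mul_pow]; norm_num : (-1 : ℝ) ^ (n + 1) * (-1) ^ (n + 1) = 1)
  rw [← hdet]
  convert hasSum_indicator_mul_det hA using 2 with ℓ
  simp only [hI]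
  rw [det_eval_neg_eq_vand ℓ p (fun j => (hF.contiguityBasis_natDegree_monic j).1) fun j =>
    (hF.contiguityBasis_natDegree_monic j).2]

end IsContiguousWeight

namespace IsContiguousWeight

variable {F : ℕ → ℤ → ℝ} {a b c d : ℝ}

open Classical in
/-- The total masses on consecutive levels are proportional, with the constant of
`hasSum_interlace`. -/
theorem tsum_mass_succ (hF : IsContiguousWeight F a b c d) (n : ℕ) :
    (∑' ℓ : {ℓ : Fin (n + 2) → ℤ // inOmega ℓ},
        (∏ i, F (n + 2) (ℓ.1 i)) * (Vand (n + 2) ℓ.1 : ℝ) ^ 2) / (n + 1).factorial =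
      ((∑' x, F (n + 2) x) * ∏ j : Fin (n + 1), (2 * (n + 1 : ℕ) + a + c - (j : ℝ))⁻¹) *
      ∑' ℓ : {ℓ : Fin (n + 1) → ℤ // inOmega ℓ},
        (∏ i, F (n + 1) (ℓ.1 i)) * (Vand (n + 1) ℓ.1 : ℝ) ^ 2 := by
  set κ := (∑' x, F (n + 2) x) * ∏ j : Fin (n + 1), (2 * (n + 1 : ℕ) + a + c - (j : ℝ))⁻¹
  let W : ∀ m, (Fin m → ℤ) → ℝ := fun m =>
    {ℓ | inOmega ℓ}.indicator fun ℓ => (∏ i, F m (ℓ i)) * (Vand m ℓ : ℝ) ^ 2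
  let g : (Fin (n + 2) → ℤ) → (Fin (n + 1) → ℤ) → ℝ := fun ℓ ℓ' =>
    if interlace ℓ' ℓ then ((∏ i, F (n + 2) (ℓ i)) * (Vand (n + 2) ℓ : ℝ)) * (Vand (n + 1) ℓ' : ℝ)
    else 0
  have hVpos : ∀ {m : ℕ} {ℓ : Fin m → ℤ}, inOmega ℓ → (0 : ℝ) < Vand m ℓ := fun h =>
    Int.cast_pos.2 (vand_pos h)
  have hg0 : 0 ≤ fun q : (Fin (n + 2) → ℤ) × (Fin (n + 1) → ℤ) => g q.1 q.2 := by
    rintro ⟨ℓ, ℓ'⟩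
    simp only [g, Pi.zero_apply]
    split_ifs with h
    · exact mul_nonneg (mul_nonneg (prod_nonneg fun i _ => (hF.pos _ _).le)
        (hVpos h.inOmega_right).le) (hVpos h.inOmega_left).le
    · exact le_rfl
  have hg1 : ∀ ℓ, HasSum (g ℓ) (W (n + 2) ℓ / (n + 1).factorial) := by
    intro ℓ
    by_cases hℓ : inOmega ℓ
    · convert! (hasSum_vand_interlace hℓ).mul_left
        ((∏ i, F (n + 2) (ℓ i)) * (Vand (n + 2) ℓ : ℝ)) using 1
      · ext ℓ'
        simp only [g, mul_ite, mul_zero]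
      · simp only [W, Set.indicator_apply, Set.mem_ofPred_eq, if_pos hℓ]
        ring
    · have : g ℓ = fun _ => 0 := funext fun ℓ' => if_neg fun h => hℓ h.inOmega_right
      rw [this]
      simp [W, hℓ]
  have hg2 : ∀ ℓ', HasSum (fun ℓ => g ℓ ℓ') (κ * W (n + 1) ℓ') := by
    intro ℓ'
    by_cases hℓ : inOmega ℓ'
    · convert! (hF.hasSum_interlace n hℓ).mul_right (Vand (n + 1) ℓ' : ℝ) using 1
      · ext ℓ
        simp only [g, ite_mul, zero_mul]
      · simp only [W, Set.indicator_apply, Set.mem_ofPred_eq, if_pos hℓ]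
        ring
    · have : (fun ℓ => g ℓ ℓ') = fun _ => 0 := funext fun ℓ => if_neg fun h => hℓ h.inOmega_left
      rw [this]
      simp [W, hℓ]
  have hs : Summable fun q : (Fin (n + 2) → ℤ) × (Fin (n + 1) → ℤ) => g q.1 q.2 := by
    refine (summable_prod_of_nonneg hg0).2 ⟨fun ℓ => (hg1 ℓ).summable, ?_⟩
    simp only [fun ℓ => (hg1 ℓ).tsum_eq]
    exact ((hF.summable_prod_mul_vand_sq (n + 1)).indicator _).div_const _
  have hcomm := Summable.tsum_comm (f := g) hs
  simp only [fun ℓ => (hg1 ℓ).tsum_eq, fun ℓ' => (hg2 ℓ').tsum_eq, tsum_mul_left,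
    tsum_div_const] at hcomm
  have hW : ∀ m, ∑' ℓ : {ℓ : Fin m → ℤ // inOmega ℓ},
      (∏ i, F m (ℓ.1 i)) * (Vand m ℓ.1 : ℝ) ^ 2 = ∑' ℓ, W m ℓ := fun m =>
    _root_.tsum_subtype {ℓ | inOmega ℓ} fun ℓ => (∏ i, F m (ℓ i)) * (Vand m ℓ : ℝ) ^ 2
  rw [hW, hW]
  exact hcomm.symm

end IsContiguousWeight

open scoped ComplexOrder

theorem Real.Gamma_mul_Gamma_pos {r r' : ℝ} (h : ∀ l : ℤ, 0 < (r - l) * (r' - l)) :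
    0 < Real.Gamma r * Real.Gamma r' := by
  suffices H : ∀ (n : ℕ) (r r' : ℝ), (∀ l : ℤ, 0 < (r - l) * (r' - l)) → -(n : ℝ) < r →
      -(n : ℝ) < r' → 0 < Real.Gamma r * Real.Gamma r' by
    obtain ⟨n, hn⟩ := exists_nat_gt (max (-r) (-r'))
    obtain ⟨h1, h2⟩ := max_lt_iff.1 hn
    exact H n r r' h (by linarith) (by linarith)
  intro n
  induction n with
  | zero =>
    intro r r' _ h1 h2
    exact mul_pos (Real.Gamma_pos_of_pos (by simpa using h1))
      (Real.Gamma_pos_of_pos (by simpa using h2))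
  | succ n ih =>
    intro r r' h h1 h2
    push_cast at h1 h2
    have h0 : 0 < r * r' := by simpa using h 0
    have := ih (r + 1) (r' + 1) (fun l => by
      have := h (l - 1)
      push_cast at this
      convert this using 1
      ring) (by linarith) (by linarith)
    rw [Real.Gamma_add_one (left_ne_zero_of_mul h0.ne'),
      Real.Gamma_add_one (right_ne_zero_of_mul h0.ne'), mul_mul_mul_comm] at this
    exact pos_of_mul_pos_right this h0.le

namespace Admissible

variable {u u' : ℂ}

theorem sub_mul_sub_pos (h : Admissible u u') (l : ℤ) : 0 < (u - l) * (u' - l) :=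
  Complex.pos_iff.2 ⟨(h l).2, (h l).1.symm⟩

theorem sub_intCast (h : Admissible u u') (k : ℤ) : Admissible (u - k) (u' - k) := fun l => by
  simpa [sub_sub] using h (k + l)

theorem im_add (h : Admissible u u') : (u + u').im = 0 := by
  have h0 := (h 0).1
  have h1 := (h 1).1
  simp at h0 h1 ⊢
  linarith

theorem ofReal_re_add (h : Admissible u u') : (((u + u').re : ℝ) : ℂ) = u + u' :=
  Complex.ext rfl h.im_add.symm

theorem ofReal_re_mul (h : Admissible u u') : (((u * u').re : ℝ) : ℂ) = u * u' :=
  Complex.ext rfl (by simpa using (h 0).1.symm)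

theorem Gamma_mul_Gamma_pos (h : Admissible u u') : 0 < Complex.Gamma u * Complex.Gamma u' := by
  have hs : u'.im = -u.im := by
    have := h.im_add
    rw [Complex.add_im] at this
    linarith
  by_cases him : u.im = 0
  · obtain ⟨r, rfl⟩ : ∃ r : ℝ, (r : ℂ) = u := ⟨u.re, Complex.ext rfl him.symm⟩
    obtain ⟨r', rfl⟩ : ∃ r' : ℝ, (r' : ℂ) = u' :=
      ⟨u'.re, Complex.ext rfl (by rw [hs, him]; simp)⟩
    rw [Complex.Gamma_ofReal, Complex.Gamma_ofReal, ← Complex.ofReal_mul, Complex.zero_lt_real]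
    exact Real.Gamma_mul_Gamma_pos fun l => by
      simpa using (h l).2
  · have hre : u'.re = u.re := by
      have := (h 0).1
      simp [hs] at this
      have h2 : u.im * (u'.re - u.re) = 0 := by linarith
      exact sub_eq_zero.1 ((mul_eq_zero.1 h2).resolve_left him)
    have hconj : u' = (starRingEnd ℂ) u := Complex.ext (by simpa using hre) (by simpa using hs)
    rw [hconj, Complex.Gamma_conj, Complex.mul_conj, Complex.zero_lt_real, Complex.normSq_pos]
    refine Complex.Gamma_ne_zero fun m hm => him ?_
    rw [hm]
    simp

end Admissible

/-- The weight on `ℤ` of the `N`-th `zw`-measure. -/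
noncomputable def zwWeight (z z' w w' : ℂ) (N : ℕ) (x : ℤ) : ℝ :=
  (1 / (Complex.Gamma (z + N - x) * Complex.Gamma (z' + N - x) *
    Complex.Gamma (w + 1 + x) * Complex.Gamma (w' + 1 + x))).re

section zwWeight

variable {z z' w w' : ℂ}

theorem Gamma_prod_pos (hz : Admissible z z') (hw : Admissible w w')
    (N : ℕ) (x : ℤ) :
    0 < Complex.Gamma (z + N - x) * Complex.Gamma (z' + N - x) *
      Complex.Gamma (w + 1 + x) * Complex.Gamma (w' + 1 + x) := by
  have h1 := (hz.sub_intCast (x - N)).Gamma_mul_Gamma_pos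
  have h2 := (hw.sub_intCast (-1 - x)).Gamma_mul_Gamma_pos
  push_cast at h1 h2
  rw [mul_assoc]
  convert mul_pos h1 h2 using 4 <;> ring_nf

theorem ofReal_zwWeight (hz : Admissible z z') (hw : Admissible w w')
    (N : ℕ) (x : ℤ) : (zwWeight z z' w w' N x : ℂ) =
    1 / (Complex.Gamma (z + N - x) * Complex.Gamma (z' + N - x) *
      Complex.Gamma (w + 1 + x) * Complex.Gamma (w' + 1 + x)) :=
  Complex.ext rfl (Complex.pos_iff.1 (one_div_pos.2 (Gamma_prod_pos hz hw N x))).2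

theorem MtC_eq_ofReal (hz : Admissible z z') (hw : Admissible w w')
    (N : ℕ) (ℓ : Fin N → ℤ) : MtC z z' w w' N ℓ =
    (((∏ i, zwWeight z z' w w' N (ℓ i)) * (Vand N ℓ : ℝ) ^ 2 : ℝ) : ℂ) := by
  rw [MtC]
  push_cast
  simp only [ofReal_zwWeight hz hw]

theorem isContiguousWeight_zwWeight (hz : Admissible z z') (hw : Admissible w w')
    (h : -1 < (z + z' + w + w').re) :
    IsContiguousWeight (zwWeight z z' w w')
      (z + z').re (z * z').re (w + w').re (w * w').re where
  pos N x := (Complex.pos_iff.1 (one_div_pos.2 (Gamma_prod_pos hz hw N x))).1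
  rec_left N x := by
    apply Complex.ofReal_injective
    have h0 := (hz.sub_mul_sub_pos (x - N)).ne'
    push_cast at h0
    obtain ⟨hz1, hz2⟩ := mul_ne_zero_iff.1 h0
    rw [← sub_add, sub_add_eq_add_sub] at hz1 hz2
    have e1 := Complex.Gamma_add_one _ hz1
    have e2 := Complex.Gamma_add_one _ hz2
    have hne := (Gamma_prod_pos hz hw N x).ne'
    simp only [mul_ne_zero_iff] at hne
    obtain ⟨⟨⟨g1, g2⟩, g3⟩, g4⟩ := hne
    rw [Complex.ofReal_mul, ofReal_zwWeight hz hw, ofReal_zwWeight hz hw]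
    simp only [Complex.ofReal_add, Complex.ofReal_mul, Complex.ofReal_pow, Complex.ofReal_sub,
      Complex.ofReal_natCast, Complex.ofReal_intCast, hz.ofReal_re_add, hz.ofReal_re_mul]
    rw [show z + ((N + 1 : ℕ) : ℂ) - x = z + N - x + 1 by push_cast; ring,
      show z' + ((N + 1 : ℕ) : ℂ) - x = z' + N - x + 1 by push_cast; ring, e1, e2]
    field_simp
    ring
  rec_right N x := by
    apply Complex.ofReal_injective
    have h0 := (hw.sub_mul_sub_pos (-x)).ne'
    push_cast at h0
    obtain ⟨hw1, hw2⟩ := mul_ne_zero_iff.1 h0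
    rw [sub_neg_eq_add] at hw1 hw2
    have e1 := Complex.Gamma_add_one _ hw1
    have e2 := Complex.Gamma_add_one _ hw2
    have hne := (Gamma_prod_pos hz hw N (x - 1)).ne'
    have s1 : ∀ v : ℂ, v + N - ((x - 1 : ℤ) : ℂ) = v + ((N + 1 : ℕ) : ℂ) - x := fun v => by
      push_cast
      ring
    have s2 : ∀ v : ℂ, v + 1 + ((x - 1 : ℤ) : ℂ) = v + x := fun v => by
      push_cast
      ring
    have s3 : ∀ v : ℂ, v + 1 + x = v + x + 1 := fun v => by ring
    simp only [s1, s2, mul_ne_zero_iff] at hne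
    obtain ⟨⟨⟨g1, g2⟩, g3⟩, g4⟩ := hne
    rw [Complex.ofReal_mul, ofReal_zwWeight hz hw, ofReal_zwWeight hz hw]
    simp only [Complex.ofReal_add, Complex.ofReal_mul, Complex.ofReal_pow,
      Complex.ofReal_intCast, hw.ofReal_re_add, hw.ofReal_re_mul]
    rw [s1, s1, s2, s2, s3, s3, e1, e2]
    field_simp
    ring
  neg_one_lt := by simpa [add_assoc] using h

end zwWeight

/-- Coherence of the `zw`-measures (Theorem 8.B): if `(z,z')` and `(w,w')` are admissible
and `z+z'+w+w' > -1`, then each `M̃_N(ℓ)` (`ℓ ∈ Ω_N`) is a positive real number, the total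
mass `S_N` is finite and positive, and the normalized distributions `M_N = M̃_N / S_N` form
a coherent family with respect to the Gelfand–Tsetlin links:
`∑_{ℓ ∈ Ω_N, ℓ' ≺ ℓ} M_N(ℓ) Dim_{N-1}(ℓ')/Dim_N(ℓ) = M_{N-1}(ℓ')`. -/
theorem zw_measures_coherent (z z' w w' : ℂ)
    (hz : Admissible z z') (hw : Admissible w w')
    (h : -1 < (z + z' + w + w').re) :
    (∀ N : ℕ, 1 ≤ N → ∀ ℓ : Fin N → ℤ, inOmega ℓ →
      (MtC z z' w w' N ℓ).im = 0 ∧ 0 < (MtC z z' w w' N ℓ).re) ∧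
    (∀ N : ℕ, 1 ≤ N →
      Summable (fun ℓ : {ℓ : Fin N → ℤ // inOmega ℓ} => (MtC z z' w w' N ℓ.1).re) ∧
      0 < Smass z z' w w' N) ∧
    (∀ M : ℕ, 1 ≤ M → ∀ ℓ' : Fin M → ℤ, inOmega ℓ' →
      ∑' ℓ : {ℓ : Fin (M + 1) → ℤ // inOmega ℓ ∧ interlace ℓ' ℓ},
          ((MtC z z' w w' (M + 1) ℓ.1).re / Smass z z' w w' (M + 1)) *
            ((DimQ M ℓ' : ℝ) / (DimQ (M + 1) ℓ.1 : ℝ))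
        = (MtC z z' w w' M ℓ').re / Smass z z' w w' M) := by
  have hF := isContiguousWeight_zwWeight hz hw h
  set F := zwWeight z z' w w'
  have hre : ∀ (N : ℕ) (ℓ : Fin N → ℤ), (MtC z z' w w' N ℓ).re =
      (∏ i, F N (ℓ i)) * (Vand N ℓ : ℝ) ^ 2 := fun N ℓ => by
    rw [MtC_eq_ofReal hz hw, Complex.ofReal_re]
  have hpos : ∀ (N : ℕ) (ℓ : Fin N → ℤ), inOmega ℓ → 0 < (MtC z z' w w' N ℓ).re := by
    intro N ℓ hℓ
    rw [hre]
    exact mul_pos (Finset.prod_pos fun i _ => hF.pos _ _)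
      (pow_pos (Int.cast_pos.2 (vand_pos hℓ)) 2)
  have hsum : ∀ n : ℕ, Summable fun ℓ : {ℓ : Fin (n + 1) → ℤ // inOmega ℓ} =>
      (MtC z z' w w' (n + 1) ℓ.1).re := fun n => by
    simp only [hre]
    exact (hF.summable_prod_mul_vand_sq n).subtype _
  have hmass : ∀ n : ℕ, 0 < Smass z z' w w' (n + 1) := fun n =>
    (hsum n).tsum_pos (fun ℓ => (hpos _ _ ℓ.2).le)
      ⟨fun i => -(i : ℤ), fun i j hij => neg_lt_neg (by exact_mod_cast hij)⟩
      (hpos _ _ fun i j hij => neg_lt_neg (by exact_mod_cast hij))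
  refine ⟨fun N _ ℓ hℓ => ⟨by rw [MtC_eq_ofReal hz hw, Complex.ofReal_im], hpos N ℓ hℓ⟩,
    fun N hN => ?_, fun M hM ℓ' hℓ' => ?_⟩
  · obtain ⟨n, rfl⟩ := Nat.exists_eq_add_of_le' hN
    exact ⟨hsum n, hmass n⟩
  · obtain ⟨n, rfl⟩ := Nat.exists_eq_add_of_le' hM
    have hS := hF.tsum_mass_succ n
    simp only [← hre] at hS
    change Smass z z' w w' (n + 2) / _ = _ * Smass z z' w w' (n + 1) at hS
    have hI := (hF.hasSum_interlace n hℓ').tsum_eq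
    set κ := (∑' x, F (n + 2) x) *
      ∏ j : Fin (n + 1), (2 * (n + 1 : ℕ) + (z + z').re + (w + w').re - (j : ℝ))⁻¹
    have hfac : (0 : ℝ) < (n + 1).factorial := by positivity
    have hterm : ∀ ℓ : {ℓ : Fin (n + 2) → ℤ // inOmega ℓ ∧ interlace ℓ' ℓ},
        ((MtC z z' w w' (n + 2) ℓ.1).re / Smass z z' w w' (n + 2)) *
          ((DimQ (n + 1) ℓ' : ℝ) / (DimQ (n + 2) ℓ.1 : ℝ)) =
        ((n + 1).factorial * (Vand (n + 1) ℓ' : ℝ) / Smass z z' w w' (n + 2)) *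
          ((∏ i, F (n + 2) (ℓ.1 i)) * (Vand (n + 2) ℓ.1 : ℝ)) := by
      rintro ⟨ℓ, hℓ, -⟩
      have hV : (Vand (n + 2) ℓ : ℝ) ≠ 0 := Int.cast_ne_zero.2 (vand_pos hℓ).ne'
      have hp : (∏ k ∈ Finset.range (n + 1), (k.factorial : ℝ)) ≠ 0 :=
        Finset.prod_ne_zero_iff.2 fun k _ => Nat.cast_ne_zero.2 k.factorial_ne_zero
      simp only [hre, DimQ, Finset.prod_range_succ _ (n + 1)]
      push_cast
      field_simp
    have hsub : ∑' ℓ : {ℓ : Fin (n + 2) → ℤ // inOmega ℓ ∧ interlace ℓ' ℓ},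
        (∏ i, F (n + 2) (ℓ.1 i)) * (Vand (n + 2) ℓ.1 : ℝ) =
        κ * ((∏ i, F (n + 1) (ℓ' i)) * (Vand (n + 1) ℓ' : ℝ)) := by
      classical
      rw [← hI]
      refine (_root_.tsum_subtype {ℓ : Fin (n + 2) → ℤ | inOmega ℓ ∧ interlace ℓ' ℓ}
        fun ℓ => (∏ i, F (n + 2) (ℓ i)) * (Vand (n + 2) ℓ : ℝ)).trans (tsum_congr fun ℓ => ?_)
      rw [Set.indicator_apply]
      exact if_congr ⟨fun h => h.2, fun h => ⟨h.inOmega_right, h⟩⟩ rfl rfl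
    rw [tsum_congr hterm, tsum_mul_left, hsub, hre, div_mul_eq_mul_div, div_eq_div_iff (hmass _).ne' (hmass _).ne']
    rw [div_eq_iff hfac.ne'] at hS
    rw [hS]
    ring
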